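/- Let F_R be the functional that maps a d-simplex Δ in ℝ^d with vertices v₀, …, v_d to F_R(Δ) = vol(Δ) · Σ_{0 ≤ i < j ≤ d} ‖v_i − v_j‖², where vol denotes d-dimensional Lebesgue measure of the convex hull. Let X ⊆ ℝ^d be a generic Delaunay set, let D be a triangulation of X all of whose d-simplices are empty (the Delaunay triangulation of X), and let T be any uniformly bounded triangulation of X. Then the densities satisfy f_R(D) ≤ f_R(T). -/

import Mathlib

open Metric MeasureTheory Filter

noncomputable section

/-- A Delaunay set with parameters `r < R`: every open ball of radius `r` contains at most
one point of `X`, and every closed ball of radius `R` contains at least one point of `X`. -/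
def DelaunaySet (d : ℕ) (X : Set (EuclideanSpace ℝ (Fin d))) (r R : ℝ) : Prop :=
  (∀ z : EuclideanSpace ℝ (Fin d), (X ∩ Metric.ball z r).Subsingleton) ∧
  (∀ z : EuclideanSpace ℝ (Fin d), (X ∩ Metric.closedBall z R).Nonempty)

/-- `T` is a triangulation of `X`: a simplicial complex with vertex set exactly `X`
whose underlying space is all of `ℝ^d`. -/
def IsTriangulationOf (d : ℕ) (T : Geometry.SimplicialComplex ℝ (EuclideanSpace ℝ (Fin d)))
    (X : Set (EuclideanSpace ℝ (Fin d))) : Prop :=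
  T.vertices = X ∧ T.space = Set.univ

/-- The finset `s` admits an enclosing sphere with radius at most `q` passing through all
its vertices; for a `d`-simplex in `ℝ^d` this says its circumradius is at most `q`. -/
def HasCircumradiusLE (d : ℕ) (s : Finset (EuclideanSpace ℝ (Fin d))) (q : ℝ) : Prop :=
  ∃ c : EuclideanSpace ℝ (Fin d), ∃ ρ : ℝ, ρ ≤ q ∧ ∀ v ∈ s, dist v c = ρ

/-- `T` is uniformly bounded with parameter `q`: every `d`-simplex of `T` has
circumradius at most `q`. -/
def UniformlyBounded (d : ℕ) (T : Geometry.SimplicialComplex ℝ (EuclideanSpace ℝ (Fin d)))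
    (q : ℝ) : Prop :=
  ∀ s ∈ T.faces, s.card = d + 1 → HasCircumradiusLE d s q

/-- The density of a functional `F` on a triangulation `T`: the lower limit, as `α → ∞`,
of the sum of `F` over the `d`-simplices of `T` contained in the closed ball of radius `α`
about the origin, divided by the volume of that ball. -/
def density (d : ℕ) (F : Finset (EuclideanSpace ℝ (Fin d)) → ℝ)
    (T : Geometry.SimplicialComplex ℝ (EuclideanSpace ℝ (Fin d))) : ℝ :=
  Filter.liminf (fun α : ℝ =>
    (∑ᶠ s ∈ {s : Finset (EuclideanSpace ℝ (Fin d)) |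
        s ∈ T.faces ∧ s.card = d + 1 ∧
          (s : Set (EuclideanSpace ℝ (Fin d))) ⊆ Metric.closedBall 0 α},
      F s) /
    (MeasureTheory.volume (Metric.closedBall (0 : EuclideanSpace ℝ (Fin d)) α)).toReal)
    Filter.atTop

/-- `X` is generic: no `d+2` points of `X` lie on a common `(d-1)`-sphere. -/
def Generic (d : ℕ) (X : Set (EuclideanSpace ℝ (Fin d))) : Prop :=
  ∀ Y : Finset (EuclideanSpace ℝ (Fin d)), ↑Y ⊆ X →
    (∃ c ρ, ∀ y ∈ Y, dist y c = ρ) → Y.card ≤ d + 1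

/-- The simplex with vertex set `s` is empty with respect to `X`: the open ball bounded by
a sphere through all vertices of `s` contains no point of `X`. -/
def EmptySimplex (d : ℕ) (s : Finset (EuclideanSpace ℝ (Fin d)))
    (X : Set (EuclideanSpace ℝ (Fin d))) : Prop :=
  ∃ c ρ, (∀ v ∈ s, dist v c = ρ) ∧ ∀ x ∈ X, ρ ≤ dist x c

/-- `D` is a Delaunay triangulation of `X`: a triangulation all of whose `d`-simplices
are empty. -/
def IsDelaunayTriangulation (d : ℕ)
    (D : Geometry.SimplicialComplex ℝ (EuclideanSpace ℝ (Fin d)))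
    (X : Set (EuclideanSpace ℝ (Fin d))) : Prop :=
  IsTriangulationOf d D X ∧ ∀ s ∈ D.faces, s.card = d + 1 → EmptySimplex d s X

/-- Rajan's functional: `F_R(Δ) = vol(Δ) · Σ_{i<j} ‖v_i − v_j‖²`, the `d`-dimensional
volume of the simplex times the sum of the squares of its edge lengths (the double sum
over ordered pairs divided by two equals the sum over unordered pairs). -/
def rajanFunctional (d : ℕ) (s : Finset (EuclideanSpace ℝ (Fin d))) : ℝ :=
  (MeasureTheory.volume (convexHull ℝ (s : Set (EuclideanSpace ℝ (Fin d))))).toReal *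
    ((∑ u ∈ s, ∑ v ∈ s, dist u v ^ 2) / 2)

theorem setIntegral_convexHull_coords_mul {d : ℕ}
    (b b' : AffineBasis (Fin (d + 1)) ℝ (EuclideanSpace ℝ (Fin d)))
    (g : (Fin (d + 1) → ℝ) → ℝ) :
    (∫ x in convexHull ℝ (Set.range b'), g (b'.coords x)) *
        volume.real (convexHull ℝ (Set.range b)) =
      (∫ x in convexHull ℝ (Set.range b), g (b.coords x)) *
        volume.real (convexHull ℝ (Set.range b')) := by
  let A : EuclideanSpace ℝ (Fin d) →ᵃ[ℝ] EuclideanSpace ℝ (Fin d) :=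
    (Fintype.linearCombination ℝ b').toAffineMap.comp b.coords
  have hAx : ∀ x, A x = ∑ i, b.coord i x • b' i := fun x => by
    simp [A, Fintype.linearCombination_apply]
  have hcoord : ∀ x, b'.coords (A x) = b.coords x := fun x => by
    ext i
    have h1 := b.sum_coord_apply_eq_one x
    rw [AffineBasis.coords_apply, AffineBasis.coords_apply, hAx,
      ← Finset.affineCombination_eq_linear_combination _ _ _ h1,
      b'.coord_apply_combination_of_mem (Finset.mem_univ i) h1]
  have hAb : ∀ i, A (b i) = b' i := fun i =>
    b'.ext_elem fun j => by
      have := congrFun (hcoord (b i)) j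
      simp only [AffineBasis.coords_apply] at this
      rw [this]
      classical rw [b.coord_apply, b'.coord_apply]
  have hinj : Function.Injective A := fun x y h =>
    b.ext_elem fun j => by
      have := congrFun (hcoord x) j
      rw [h, hcoord] at this
      simpa using this.symm
  have himg : convexHull ℝ (Set.range b') = A '' convexHull ℝ (Set.range b) := by
    rw [AffineMap.image_convexHull, ← Set.range_comp]
    congr 2
    exact (funext hAb).symm
  have hfd : ∀ x, HasFDerivAt A (LinearMap.toContinuousLinearMap A.linear) x := fun x => by
    rw [AffineMap.decomp A]
    exact (LinearMap.toContinuousLinearMap A.linear).hasFDerivAt.add_const _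
  have hmeas : MeasurableSet (convexHull ℝ (Set.range b)) :=
    (Set.finite_range b).isCompact_convexHull ℝ |>.isClosed.measurableSet
  have key : ∀ h : EuclideanSpace ℝ (Fin d) → ℝ,
      ∫ x in convexHull ℝ (Set.range b'), h x =
        |(LinearMap.toContinuousLinearMap A.linear).det| *
          ∫ x in convexHull ℝ (Set.range b), h (A x) := fun h => by
    rw [himg, integral_image_eq_integral_abs_det_fderiv_smul volume hmeas
      (fun x _ => (hfd x).hasFDerivWithinAt) hinj.injOn, ← integral_const_mul]
    simp
  have h1 := key fun _ => 1
  simp only [setIntegral_const, smul_eq_mul, mul_one] at h1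
  rw [key, h1]
  simp only [hcoord]
  ring

theorem exists_perm_apply_eq_apply_eq {ι : Type*} {i j i' j' : ι} (h : i ≠ j) (h' : i' ≠ j') :
    ∃ σ : Equiv.Perm ι, σ i = i' ∧ σ j = j' := by
  classical
  refine ⟨(Equiv.swap i i').trans (Equiv.swap (Equiv.swap i i' j) j'), ?_, by simp⟩
  rw [Equiv.trans_apply, Equiv.swap_apply_left, Equiv.swap_apply_of_ne_of_ne _ h']
  intro hc
  apply h
  apply (Equiv.swap i i').injective
  rw [← hc, Equiv.swap_apply_left]

theorem volume_real_convexHull_affineBasis_pos {d : ℕ}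
    (b : AffineBasis (Fin (d + 1)) ℝ (EuclideanSpace ℝ (Fin d))) :
    0 < volume.real (convexHull ℝ (Set.range b)) := by
  have hc : IsCompact (convexHull ℝ (Set.range b)) := (Set.finite_range b).isCompact_convexHull ℝ
  have hi : (interior (convexHull ℝ (Set.range b))).Nonempty :=
    interior_convexHull_nonempty_iff_affineSpan_eq_top.2 b.tot
  exact ENNReal.toReal_pos ((isOpen_interior.measure_pos volume hi).trans_le
    (measure_mono interior_subset)).ne' hc.measure_lt_top.ne

/-- On every simplex the mean value of a product of two distinct barycentric coordinates is the
same positive constant. -/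
theorem exists_setIntegral_coord_mul_coord (d : ℕ) :
    ∃ K : ℝ, 0 < K ∧ ∀ b : AffineBasis (Fin (d + 1)) ℝ (EuclideanSpace ℝ (Fin d)),
      ∀ i j, i ≠ j → ∫ x in convexHull ℝ (Set.range b), b.coord i x * b.coord j x =
        K * volume.real (convexHull ℝ (Set.range b)) := by
  by_cases hd : ∃ i j : Fin (d + 1), i ≠ j
  swap
  · exact ⟨1, one_pos, fun b i j hij => (hd ⟨i, j, hij⟩).elim⟩
  obtain ⟨i₀, j₀, h₀⟩ := hd
  obtain ⟨b₀⟩ := AffineBasis.exists_affineBasis_of_finiteDimensional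
    (ι := Fin (d + 1)) (k := ℝ) (P := EuclideanSpace ℝ (Fin d)) (by simp)
  have hv := volume_real_convexHull_affineBasis_pos b₀
  refine ⟨(∫ x in convexHull ℝ (Set.range b₀), b₀.coord i₀ x * b₀.coord j₀ x) /
    volume.real (convexHull ℝ (Set.range b₀)), div_pos ?_ hv, fun b i j hij => ?_⟩
  · have hc : IsCompact (convexHull ℝ (Set.range b₀)) :=
      (Set.finite_range b₀).isCompact_convexHull ℝ
    have hcont : Continuous fun x => b₀.coord i₀ x * b₀.coord j₀ x :=
      (AffineMap.continuous_of_finiteDimensional _).mul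
        (AffineMap.continuous_of_finiteDimensional _)
    have hnn : ∀ x ∈ convexHull ℝ (Set.range b₀), 0 ≤ b₀.coord i₀ x * b₀.coord j₀ x := by
      intro x hx
      rw [AffineBasis.convexHull_eq_nonneg_coord] at hx
      exact mul_nonneg (hx _) (hx _)
    rw [setIntegral_pos_iff_support_of_nonneg_ae
      (ae_restrict_of_forall_mem hc.isClosed.measurableSet hnn)
      (hcont.continuousOn.integrableOn_compact hc)]
    have hi : (interior (convexHull ℝ (Set.range b₀))).Nonempty :=
      interior_convexHull_nonempty_iff_affineSpan_eq_top.2 b₀.tot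
    refine (isOpen_interior.measure_pos volume hi).trans_le (measure_mono fun x hx => ?_)
    refine ⟨?_, interior_subset hx⟩
    rw [AffineBasis.interior_convexHull] at hx
    exact (mul_pos (hx _) (hx _)).ne'
  · obtain ⟨σ, hσi, hσj⟩ := exists_perm_apply_eq_apply_eq h₀ hij
    have := setIntegral_convexHull_coords_mul b₀ (b.reindex σ.symm) fun w => w i₀ * w j₀
    have hr : Set.range (b.reindex σ.symm) = Set.range b := by
      rw [AffineBasis.coe_reindex]; simp
    simp only [AffineBasis.coords_apply, AffineBasis.coord_reindex, hr, Equiv.symm_symm,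
      hσi, hσj] at this
    field_simp
    linarith

theorem sum_mul_dist_sq_eq {ι E : Type*} [Fintype ι] [NormedAddCommGroup E]
    [InnerProductSpace ℝ E] (w : ι → ℝ) (p : ι → E) (hw : ∑ i, w i = 1) (c : E) :
    (∑ i, ∑ j, w i * w j * dist (p i) (p j) ^ 2) / 2 =
      ∑ i, w i * dist (p i) c ^ 2 - dist (∑ i, w i • p i) c ^ 2 := by
  have hx : ∑ i, w i • p i - c = ∑ i, w i • (p i - c) := by
    simp only [smul_sub, Finset.sum_sub_distrib, ← Finset.sum_smul, hw, one_smul]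
  have hn : dist (∑ i, w i • p i) c ^ 2 =
      ∑ i, ∑ j, w i * w j * inner ℝ (p i - c) (p j - c) := by
    rw [dist_eq_norm, hx, ← real_inner_self_eq_norm_sq, sum_inner]
    refine Finset.sum_congr rfl fun i _ => ?_
    rw [inner_sum]
    refine Finset.sum_congr rfl fun j _ => ?_
    rw [real_inner_smul_left, real_inner_smul_right]
    ring
  have h1 : ∀ i j, w i * w j * dist (p i) (p j) ^ 2 =
      w i * dist (p i) c ^ 2 * w j + w i * (w j * dist (p j) c ^ 2) -
        2 * (w i * w j * inner ℝ (p i - c) (p j - c)) := fun i j => by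
    have : p i - p j = (p i - c) - (p j - c) := by abel
    rw [dist_eq_norm (p i) (p j), this, norm_sub_sq_real, dist_eq_norm, dist_eq_norm]
    ring
  rw [hn]
  simp only [h1, Finset.sum_sub_distrib, Finset.sum_add_distrib, ← Finset.mul_sum,
    ← Finset.sum_mul, hw]
  ring

theorem exists_affineBasis_range_eq {d : ℕ} {s : Finset (EuclideanSpace ℝ (Fin d))}
    (hs : AffineIndependent ℝ ((↑) : s → EuclideanSpace ℝ (Fin d))) (hcard : s.card = d + 1) :
    ∃ b : AffineBasis (Fin (d + 1)) ℝ (EuclideanSpace ℝ (Fin d)),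
      Set.range b = (s : Set (EuclideanSpace ℝ (Fin d))) := by
  let b : AffineBasis s ℝ (EuclideanSpace ℝ (Fin d)) :=
    ⟨(↑), hs, hs.affineSpan_eq_top_iff_card_eq_finrank_add_one.2 (by simpa using hcard)⟩
  refine ⟨b.reindex (s.equivFinOfCardEq hcard), ?_⟩
  rw [AffineBasis.coe_reindex, EquivLike.range_comp]
  exact Subtype.range_coe

/-- Rajan's functional is, up to a constant factor, the integral over the simplex of the error
made when interpolating the squared norm linearly. -/
theorem exists_interpolation_error (d : ℕ) :
    ∃ K : ℝ, 0 < K ∧ ∀ s : Finset (EuclideanSpace ℝ (Fin d)),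
      AffineIndependent ℝ ((↑) : s → EuclideanSpace ℝ (Fin d)) → s.card = d + 1 →
      ∃ e : EuclideanSpace ℝ (Fin d) → ℝ, Continuous e ∧
        (∫ x in convexHull ℝ (s : Set (EuclideanSpace ℝ (Fin d))), e x) =
          K * rajanFunctional d s ∧
        (∀ x ∈ convexHull ℝ (s : Set (EuclideanSpace ℝ (Fin d))), ∀ c m,
          (∀ v ∈ s, m ≤ dist v c ^ 2) → m - dist x c ^ 2 ≤ e x) ∧
        (∀ x ∈ convexHull ℝ (s : Set (EuclideanSpace ℝ (Fin d))), ∀ c m,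
          (∀ v ∈ s, dist v c ^ 2 ≤ m) → e x ≤ m - dist x c ^ 2) := by
  obtain ⟨K, hK, hint⟩ := exists_setIntegral_coord_mul_coord d
  refine ⟨K, hK, fun s hs hcard => ?_⟩
  obtain ⟨b, hb⟩ := exists_affineBasis_range_eq hs hcard
  have hmem : ∀ i, b i ∈ s := fun i => by
    rw [← Finset.mem_coe, ← hb]; exact Set.mem_range_self i
  have hcoord : ∀ i, Continuous (b.coord i) := fun i =>
    AffineMap.continuous_of_finiteDimensional _
  have hcomp : IsCompact (convexHull ℝ (Set.range b)) := (Set.finite_range b).isCompact_convexHull ℝ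
  have hid : ∀ x c, (∑ i, ∑ j, b.coord i x * b.coord j x * dist (b i) (b j) ^ 2) / 2 =
      ∑ i, b.coord i x * dist (b i) c ^ 2 - dist x c ^ 2 := fun x c => by
    rw [sum_mul_dist_sq_eq _ _ (b.sum_coord_apply_eq_one x) c, b.linear_combination_coord_eq_self]
  refine ⟨fun x => (∑ i, ∑ j, b.coord i x * b.coord j x * dist (b i) (b j) ^ 2) / 2,
    by fun_prop, ?_, fun x hx c m hm => ?_, fun x hx c m hm => ?_⟩
  · have hsum : ∀ f : EuclideanSpace ℝ (Fin d) → ℝ, ∑ u ∈ s, f u = ∑ i, f (b i) := fun f => by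
      classical
      have : s = Finset.univ.image b := by
        apply Finset.coe_injective; simp [hb]
      rw [this, Finset.sum_image b.ind.injective.injOn]
    have hterm : ∀ i j, ∫ x in convexHull ℝ (Set.range b),
        b.coord i x * b.coord j x * dist (b i) (b j) ^ 2 =
          K * volume.real (convexHull ℝ (Set.range b)) * dist (b i) (b j) ^ 2 := fun i j => by
      rcases eq_or_ne i j with rfl | hij
      · simp
      · rw [integral_mul_const, hint b i j hij]
    have hi : ∀ i j, IntegrableOn (fun x => b.coord i x * b.coord j x * dist (b i) (b j) ^ 2)
        (convexHull ℝ (Set.range b)) := fun i j =>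
      (Continuous.continuousOn (by fun_prop)).integrableOn_compact hcomp
    rw [rajanFunctional, ← hb, integral_div, integral_finsetSum _
      fun i _ => integrable_finsetSum _ fun j _ => hi i j]
    simp only [integral_finsetSum _ fun j _ => hi _ j, hterm, hsum, ← Finset.mul_sum, measureReal_def]
    ring
  all_goals
    rw [← hb, AffineBasis.convexHull_eq_nonneg_coord] at hx
    simp only [hid x c]
    have h1 : m = ∑ i, b.coord i x * m := by
      rw [← Finset.sum_mul, b.sum_coord_apply_eq_one, one_mul]
    refine sub_le_sub_right (h1.symm ▸ ?_) _
    exact Finset.sum_le_sum fun i _ => mul_le_mul_of_nonneg_left (hm _ (hmem i)) (hx i)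

theorem volume_convexHull_eq_zero_of_card_le {d : ℕ} {s : Finset (EuclideanSpace ℝ (Fin d))}
    (hs : s.card ≤ d) : volume (convexHull ℝ (s : Set (EuclideanSpace ℝ (Fin d)))) = 0 := by
  classical
  refine measure_mono_null (convexHull_subset_affineSpan _)
    (Measure.addHaar_affineSubspace volume _ fun htop => ?_)
  rcases s.eq_empty_or_nonempty with rfl | hne
  · simp at htop
  · have hcard : s.card = s.card - 1 + 1 := (Nat.succ_pred_eq_of_pos hne.card_pos).symm
    have h1 := finrank_vectorSpan_image_finset_le ℝ id s hcard
    rw [Finset.image_id, ← direction_affineSpan, htop, AffineSubspace.direction_top,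
      finrank_top, finrank_euclideanSpace_fin] at h1
    omega

theorem DelaunaySet.finite_inter_closedBall {d : ℕ} {X : Set (EuclideanSpace ℝ (Fin d))}
    {r R : ℝ} (hX : DelaunaySet d X r R) (hr : 0 < r) (c : EuclideanSpace ℝ (Fin d)) (α : ℝ) :
    (X ∩ closedBall c α).Finite := by
  obtain ⟨t, -, htf, hcov⟩ := (isCompact_closedBall c α).finite_cover_balls hr
  refine (htf.biUnion fun z _ => (hX.1 z).finite).subset fun x hx => ?_
  obtain ⟨z, hz, hxz⟩ := Set.mem_iUnion₂.1 (hcov hx.2)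
  exact Set.mem_iUnion₂.2 ⟨z, hz, hx.1, hxz⟩

theorem DelaunaySet.countable {d : ℕ} {X : Set (EuclideanSpace ℝ (Fin d))}
    {r R : ℝ} (hX : DelaunaySet d X r R) (hr : 0 < r) : X.Countable := by
  refine (Set.countable_iUnion fun n : ℕ =>
    (hX.finite_inter_closedBall hr 0 n).countable).mono fun x hx => ?_
  obtain ⟨n, hn⟩ := exists_nat_ge ‖x‖
  exact Set.mem_iUnion.2 ⟨n, hx, by simpa using hn⟩

section Triangulation

variable {d : ℕ} {T : Geometry.SimplicialComplex ℝ (EuclideanSpace ℝ (Fin d))}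
  {X : Set (EuclideanSpace ℝ (Fin d))} {r R : ℝ}

theorem IsTriangulationOf.coe_subset (hT : IsTriangulationOf d T X)
    {s : Finset (EuclideanSpace ℝ (Fin d))} (hs : s ∈ T.faces) :
    (s : Set (EuclideanSpace ℝ (Fin d))) ⊆ X := fun v hv => by
  rw [← hT.1, Geometry.SimplicialComplex.mem_vertices]
  exact T.down_closed hs (by simpa using hv) (Finset.singleton_nonempty v)

theorem IsTriangulationOf.ae_mem_simplex (hT : IsTriangulationOf d T X) (hX : X.Countable) :
    ∀ᵐ x : EuclideanSpace ℝ (Fin d), ∃ s ∈ T.faces, s.card = d + 1 ∧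
      x ∈ convexHull ℝ (s : Set (EuclideanSpace ℝ (Fin d))) := by
  have hc : T.faces.Countable := by
    refine ((Set.countable_ofPred_finite_subset hX).preimage
      (Finset.coe_injective (α := EuclideanSpace ℝ (Fin d)))).mono fun s hs => ?_
    exact And.intro s.finite_toSet (hT.coe_subset hs)
  have h : ∀ᵐ x : EuclideanSpace ℝ (Fin d), ∀ s ∈ T.faces, s.card ≤ d →
      x ∉ convexHull ℝ (s : Set (EuclideanSpace ℝ (Fin d))) := by
    rw [ae_ball_iff hc]
    intro s _
    by_cases hsd : s.card ≤ d
    · filter_upwards [measure_eq_zero_iff_ae_notMem.1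
        (volume_convexHull_eq_zero_of_card_le hsd)] with x hx _ using hx
    · exact Eventually.of_forall fun x h => absurd h hsd
  filter_upwards [h] with x hx
  obtain ⟨s, hs, hxs⟩ := Geometry.SimplicialComplex.mem_space_iff.1
    (hT.2.symm ▸ Set.mem_univ x : x ∈ T.space)
  refine ⟨s, hs, le_antisymm ?_ ?_, hxs⟩
  · have h1 := (T.indep hs).card_le_finrank_succ
    have h2 := Submodule.finrank_le
      (vectorSpan ℝ (Set.range ((↑) : s → EuclideanSpace ℝ (Fin d))))
    rw [finrank_euclideanSpace_fin] at h2
    rw [Fintype.card_coe] at h1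
    omega
  · by_contra hlt
    exact hx s hs (by omega) hxs

theorem ae_eq_of_mem_simplex (T : Geometry.SimplicialComplex ℝ (EuclideanSpace ℝ (Fin d)))
    (A : Finset (Finset (EuclideanSpace ℝ (Fin d))))
    (hA : ∀ s ∈ A, s ∈ T.faces ∧ s.card = d + 1) :
    ∀ᵐ x : EuclideanSpace ℝ (Fin d), ∀ s ∈ A, ∀ t ∈ A,
      x ∈ convexHull ℝ (s : Set (EuclideanSpace ℝ (Fin d))) →
      x ∈ convexHull ℝ (t : Set (EuclideanSpace ℝ (Fin d))) → s = t := by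
  classical
  refine (ae_ball_iff A.countable_toSet).2 fun s hs => (ae_ball_iff A.countable_toSet).2
    fun t ht => ?_
  rcases eq_or_ne s t with rfl | hst
  · exact Eventually.of_forall fun x _ _ => rfl
  have hcard : (s ∩ t).card ≤ d := by
    by_contra! hlt
    have h1 : s ∩ t = s := Finset.eq_of_subset_of_card_le Finset.inter_subset_left
      (by rw [(hA s hs).2]; omega)
    have h2 : s ∩ t = t := Finset.eq_of_subset_of_card_le Finset.inter_subset_right
      (by rw [(hA t ht).2]; omega)
    exact hst (h1.symm.trans h2)
  filter_upwards [measure_eq_zero_iff_ae_notMem.1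
    (volume_convexHull_eq_zero_of_card_le hcard)] with x hx hxs hxt
  rw [Finset.coe_inter] at hx
  exact (hx (T.inter_subset_convexHull (hA s hs).1 (hA t ht).1 ⟨hxs, hxt⟩)).elim

/-- If the interior-disjoint simplices `s ∈ A` carry functions `e s` that are dominated by a
nonnegative function `h`, then the integrals of the `e s` add up to at most the integral of `h`. -/
theorem sum_setIntegral_simplex_le (T : Geometry.SimplicialComplex ℝ (EuclideanSpace ℝ (Fin d)))
    (A : Finset (Finset (EuclideanSpace ℝ (Fin d))))
    (hA : ∀ s ∈ A, s ∈ T.faces ∧ s.card = d + 1)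
    (e : Finset (EuclideanSpace ℝ (Fin d)) → EuclideanSpace ℝ (Fin d) → ℝ)
    (he : ∀ s ∈ A, Continuous (e s)) (h : EuclideanSpace ℝ (Fin d) → ℝ) (hint : Integrable h)
    (hnn : ∀ x, 0 ≤ h x)
    (hle : ∀ᵐ x, ∀ s ∈ A, x ∈ convexHull ℝ (s : Set (EuclideanSpace ℝ (Fin d))) → e s x ≤ h x) :
    ∑ s ∈ A, ∫ x in convexHull ℝ (s : Set (EuclideanSpace ℝ (Fin d))), e s x ≤ ∫ x, h x := by
  classical
  have hcomp : ∀ s : Finset (EuclideanSpace ℝ (Fin d)),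
      IsCompact (convexHull ℝ (s : Set (EuclideanSpace ℝ (Fin d)))) := fun s =>
    s.finite_toSet.isCompact_convexHull ℝ
  have hind : ∀ s ∈ A, Integrable
      ((convexHull ℝ (s : Set (EuclideanSpace ℝ (Fin d)))).indicator (e s)) := fun s hs =>
    (integrable_indicator_iff (hcomp s).isClosed.measurableSet).2
      ((he s hs).continuousOn.integrableOn_compact (hcomp s))
  simp only [← integral_indicator (hcomp _).isClosed.measurableSet]
  rw [← integral_finsetSum _ hind]
  refine integral_mono_ae (integrable_finsetSum _ hind) hint ?_
  filter_upwards [hle, ae_eq_of_mem_simplex T A hA] with x hx huniq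
  by_cases hex : ∃ s ∈ A, x ∈ convexHull ℝ (s : Set (EuclideanSpace ℝ (Fin d)))
  · obtain ⟨s, hs, hxs⟩ := hex
    rw [Finset.sum_eq_single s (fun t ht hts => Set.indicator_of_notMem
      (fun hxt => hts (huniq t ht s hs hxt hxs)) _) (fun h => (h hs).elim),
      Set.indicator_of_mem hxs]
    exact hx s hs hxs
  · rw [Finset.sum_eq_zero fun s hs => Set.indicator_of_notMem (fun hxs => hex ⟨s, hs, hxs⟩) _]
    exact hnn x

theorem IsTriangulationOf.finite_simplices (hT : IsTriangulationOf d T X)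
    (hX : DelaunaySet d X r R) (hr : 0 < r) (α : ℝ) :
    {s : Finset (EuclideanSpace ℝ (Fin d)) | s ∈ T.faces ∧ s.card = d + 1 ∧
      (s : Set (EuclideanSpace ℝ (Fin d))) ⊆ closedBall 0 α}.Finite := by
  refine ((hX.finite_inter_closedBall hr 0 α).finite_subsets.preimage
    Finset.coe_injective.injOn).subset fun s hs => ?_
  exact Set.subset_inter (hT.coe_subset hs.1) hs.2.2

theorem IsDelaunayTriangulation.exists_circumsphere {D : Geometry.SimplicialComplex ℝ
      (EuclideanSpace ℝ (Fin d))}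
    (hD : IsDelaunayTriangulation d D X) (hX : DelaunaySet d X r R)
    {s : Finset (EuclideanSpace ℝ (Fin d))} (hs : s ∈ D.faces) (hcard : s.card = d + 1) :
    ∃ c ρ, 0 ≤ ρ ∧ ρ ≤ R ∧ (∀ v ∈ s, dist v c = ρ) ∧ ∀ x ∈ X, ρ ≤ dist x c := by
  obtain ⟨c, ρ, h1, h2⟩ := hD.2 s hs hcard
  obtain ⟨v, hv⟩ := Finset.card_pos.1 (by omega : 0 < s.card)
  obtain ⟨y, hyX, hy⟩ := hX.2 c
  exact ⟨c, ρ, h1 v hv ▸ dist_nonneg, (h2 y hyX).trans hy, h1, h2⟩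

end Triangulation

theorem volume_real_closedBall_diff {d : ℕ} {α β : ℝ} (hβ : 0 ≤ β) (h : β ≤ α) :
    volume.real (closedBall (0 : EuclideanSpace ℝ (Fin d)) α \ closedBall 0 β) =
      (α ^ d - β ^ d) * volume.real (ball (0 : EuclideanSpace ℝ (Fin d)) 1) := by
  rw [measureReal_sdiff (closedBall_subset_closedBall h) measurableSet_closedBall
    measure_closedBall_lt_top.ne,
    Measure.addHaar_real_closedBall _ _ (hβ.trans h), Measure.addHaar_real_closedBall _ _ hβ,
    finrank_euclideanSpace_fin, sub_mul]

theorem tendsto_volume_shell_div_volume_closedBall (d : ℕ) {δ : ℝ} (hδ : 0 ≤ δ) :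
    Tendsto (fun α : ℝ =>
      volume.real (closedBall (0 : EuclideanSpace ℝ (Fin d)) α \ closedBall 0 (α - δ)) /
        volume.real (closedBall (0 : EuclideanSpace ℝ (Fin d)) α)) atTop (nhds 0) := by
  have h1 : Tendsto (fun α : ℝ => 1 - (1 - δ / α) ^ d) atTop (nhds 0) := by
    have := ((tendsto_const_nhds.div_atTop tendsto_id : Tendsto (fun α : ℝ => δ / α) atTop
      (nhds 0)).const_sub 1).pow d |>.const_sub 1
    simpa using this
  refine h1.congr' ?_
  filter_upwards [eventually_ge_atTop δ, eventually_gt_atTop 0] with α hα hα0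
  have hb : 0 < volume.real (ball (0 : EuclideanSpace ℝ (Fin d)) 1) :=
    ENNReal.toReal_pos (measure_ball_pos _ _ one_pos).ne' measure_ball_lt_top.ne
  rw [volume_real_closedBall_diff (sub_nonneg.2 hα) (sub_le_self α hδ),
    Measure.addHaar_real_closedBall _ _ hα0.le, finrank_euclideanSpace_fin,
    mul_div_mul_right _ _ hb.ne', sub_div, div_self (pow_pos hα0 d).ne', ← div_pow, sub_div,
    div_self hα0.ne']

theorem liminf_le_liminf_of_le_add {f g ε : ℝ → ℝ} (hf : ∀ᶠ α in atTop, 0 ≤ f α)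
    (hε : Tendsto ε atTop (nhds 0)) {M : ℝ} (hg : ∀ᶠ α in atTop, g α ≤ M)
    (h : ∀ᶠ α in atTop, f α ≤ g α + ε α) :
    liminf f atTop ≤ liminf g atTop := by
  refine csSup_le ⟨0, by simpa using hf⟩ fun c hc => le_of_forall_pos_sub_le fun δ hδ => ?_
  refine le_liminf_of_le (IsCoboundedUnder.of_frequently_le hg.frequently) ?_
  have hc' : ∀ᶠ α in atTop, c ≤ f α := hc
  filter_upwards [h, hc', hε.eventually_lt_const hδ] with α h1 h2 h3
  linarith

theorem rajanFunctional_nonneg (d : ℕ) (s : Finset (EuclideanSpace ℝ (Fin d))) :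
    0 ≤ rajanFunctional d s := by
  unfold rajanFunctional; positivity

/-- Corollary B: the Delaunay triangulation of a generic Delaunay set minimizes the density
of Rajan's functional `F_R` among all uniformly bounded triangulations. -/
theorem rajan_density_minimized (d : ℕ) (X : Set (EuclideanSpace ℝ (Fin d))) (r R : ℝ)
    (hr : 0 < r) (hrR : r < R) (hX : DelaunaySet d X r R) (hgen : Generic d X)
    (D : Geometry.SimplicialComplex ℝ (EuclideanSpace ℝ (Fin d)))
    (hD : IsDelaunayTriangulation d D X)
    (T : Geometry.SimplicialComplex ℝ (EuclideanSpace ℝ (Fin d)))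
    (hT : IsTriangulationOf d T X) (q : ℝ) (hq : 0 < q) (hTq : UniformlyBounded d T q) :
    density d (rajanFunctional d) D ≤ density d (rajanFunctional d) T := by
  obtain ⟨K, hK, hE⟩ := exists_interpolation_error d
  choose! e he hint hlow hupp using hE
  have hcount := hX.countable hr
  have hfD := hD.1.finite_simplices hX hr
  have hfT := hT.finite_simplices hX hr
  have hsumD : ∀ α, ∑ᶠ (s) (_ : s ∈ D.faces ∧ s.card = d + 1 ∧
      (s : Set (EuclideanSpace ℝ (Fin d))) ⊆ closedBall 0 α), rajanFunctional d s =
        ∑ s ∈ (hfD α).toFinset, rajanFunctional d s := fun α =>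
    finsum_mem_eq_finite_toFinset_sum _ (hfD α)
  have hsumT : ∀ α, ∑ᶠ (s) (_ : s ∈ T.faces ∧ s.card = d + 1 ∧
      (s : Set (EuclideanSpace ℝ (Fin d))) ⊆ closedBall 0 α), rajanFunctional d s =
        ∑ s ∈ (hfT α).toFinset, rajanFunctional d s := fun α =>
    finsum_mem_eq_finite_toFinset_sum _ (hfT α)
  have hV : ∀ᶠ α : ℝ in atTop,
      0 < volume.real (closedBall (0 : EuclideanSpace ℝ (Fin d)) α) := by
    filter_upwards [eventually_gt_atTop 0] with α hα
    exact ENNReal.toReal_pos (measure_closedBall_pos _ _ hα).ne' measure_closedBall_lt_top.ne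
  have hcomp : ∀ s : Finset (EuclideanSpace ℝ (Fin d)),
      IsCompact (convexHull ℝ (s : Set (EuclideanSpace ℝ (Fin d)))) := fun s =>
    s.finite_toSet.isCompact_convexHull ℝ
  have henn : ∀ s ∈ T.faces, s.card = d + 1 →
      ∀ x ∈ convexHull ℝ (s : Set (EuclideanSpace ℝ (Fin d))), 0 ≤ e s x :=
    fun s hs hc x hx => by
      simpa using hlow s (T.indep hs) hc x hx x 0 fun v _ => sq_nonneg _
  have hcirc : ∀ s ∈ T.faces, s.card = d + 1 →
      ∃ c ρ, 0 ≤ ρ ∧ ρ ≤ q ∧ ∀ v ∈ s, dist v c = ρ := fun s hs hc => by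
    obtain ⟨c, ρ, h1, h2⟩ := hTq s hs hc
    obtain ⟨v, hv⟩ := Finset.card_pos.1 (by omega : 0 < s.card)
    exact ⟨c, ρ, h2 v hv ▸ dist_nonneg, h1, h2⟩
  refine liminf_le_liminf_of_le_add (M := q ^ 2 / K)
    (ε := fun α => R ^ 2 / K *
      (volume.real (closedBall (0 : EuclideanSpace ℝ (Fin d)) α \ closedBall 0 (α - 2 * q)) /
        volume.real (closedBall (0 : EuclideanSpace ℝ (Fin d)) α))) ?_ ?_ ?_ ?_
  · exact Eventually.of_forall fun α => div_nonneg
      (finsum_nonneg fun s => finsum_nonneg fun _ => rajanFunctional_nonneg d s) ENNReal.toReal_nonneg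
  · simpa using (tendsto_volume_shell_div_volume_closedBall d
      (mul_nonneg zero_le_two hq.le)).const_mul (R ^ 2 / K)
  · filter_upwards [hV] with α hVα
    rw [← measureReal_def, div_le_iff₀ hVα, div_mul_eq_mul_div, le_div_iff₀ hK, mul_comm,
      hsumT, Finset.mul_sum]
    have hmem : ∀ s ∈ (hfT α).toFinset, s ∈ T.faces ∧ s.card = d + 1 ∧
        (s : Set (EuclideanSpace ℝ (Fin d))) ⊆ closedBall 0 α := fun s hs =>
        (hfT α).mem_toFinset.1 hs
    have := sum_setIntegral_simplex_le T (hfT α).toFinset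
      (fun s hs => ⟨(hmem s hs).1, (hmem s hs).2.1⟩) e
      (fun s hs => he s (T.indep (hmem s hs).1) (hmem s hs).2.1)
      ((closedBall (0 : EuclideanSpace ℝ (Fin d)) α).indicator fun _ => q ^ 2)
      ((integrable_indicator_iff measurableSet_closedBall).2
        (integrableOn_const measure_closedBall_lt_top.ne))
      (Set.indicator_nonneg fun _ _ => sq_nonneg q)
      (Eventually.of_forall fun x s hs hx => ?_)
    · rw [integral_indicator measurableSet_closedBall, setIntegral_const, smul_eq_mul,
        mul_comm] at this
      rw [← Finset.sum_congr rfl fun s hs =>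
        hint s (T.indep (hmem s hs).1) (hmem s hs).2.1]
      exact this
    · obtain ⟨hsT, hsc, hsα⟩ := hmem s hs
      rw [Set.indicator_of_mem (convexHull_min hsα (convex_closedBall _ _) hx)]
      obtain ⟨c, ρ, hρ0, hρ, hs'⟩ := hcirc s hsT hsc
      have h1 := hupp s (T.indep hsT) hsc x hx c (q ^ 2) fun v hv => by
        rw [hs' v hv]; exact pow_le_pow_left₀ hρ0 hρ 2
      exact h1.trans (sub_le_self _ (sq_nonneg _))
  · filter_upwards [hV] with α hVα
    rw [← measureReal_def, ← mul_div_assoc, ← add_div]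
    refine div_le_div_of_nonneg_right ?_ hVα.le
    rw [div_mul_eq_mul_div, ← sub_le_iff_le_add', le_div_iff₀ hK, sub_mul, sub_le_iff_le_add',
      mul_comm _ K, mul_comm _ K, hsumT, hsumD, Finset.mul_sum, Finset.mul_sum]
    have hmemD : ∀ s ∈ (hfD α).toFinset, s ∈ D.faces ∧ s.card = d + 1 ∧
        (s : Set (EuclideanSpace ℝ (Fin d))) ⊆ closedBall 0 α := fun s hs =>
        (hfD α).mem_toFinset.1 hs
    have hmemT : ∀ s, s ∈ (hfT α).toFinset ↔ s ∈ T.faces ∧ s.card = d + 1 ∧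
        (s : Set (EuclideanSpace ℝ (Fin d))) ⊆ closedBall 0 α := fun s =>
        (hfT α).mem_toFinset
    have hindT : ∀ s ∈ (hfT α).toFinset, Integrable
        ((convexHull ℝ (s : Set (EuclideanSpace ℝ (Fin d)))).indicator (e s)) := fun s hs =>
      (integrable_indicator_iff (hcomp s).isClosed.measurableSet).2
        ((he s (T.indep ((hmemT s).1 hs).1)
          ((hmemT s).1 hs).2.1).continuousOn.integrableOn_compact (hcomp s))
    have hsumnn : ∀ x, 0 ≤ ∑ s ∈ (hfT α).toFinset,
        (convexHull ℝ (s : Set (EuclideanSpace ℝ (Fin d)))).indicator (e s) x := fun x =>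
      Finset.sum_nonneg fun s hs => Set.indicator_nonneg
        (henn s ((hmemT s).1 hs).1 ((hmemT s).1 hs).2.1) x
    have hshell : MeasurableSet
        (closedBall (0 : EuclideanSpace ℝ (Fin d)) α \ closedBall 0 (α - 2 * q)) :=
      measurableSet_closedBall.diff measurableSet_closedBall
    have hshellint : Integrable
        ((closedBall (0 : EuclideanSpace ℝ (Fin d)) α \ closedBall 0 (α - 2 * q)).indicator
          fun _ => R ^ 2) :=
      (integrable_indicator_iff hshell).2 (integrableOn_const
        ((measure_mono Set.sdiff_subset).trans_lt measure_closedBall_lt_top).ne)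
    have := sum_setIntegral_simplex_le D (hfD α).toFinset
      (fun s hs => ⟨(hmemD s hs).1, (hmemD s hs).2.1⟩) e
      (fun s hs => he s (D.indep (hmemD s hs).1) (hmemD s hs).2.1)
      (fun x => ∑ s ∈ (hfT α).toFinset,
        (convexHull ℝ (s : Set (EuclideanSpace ℝ (Fin d)))).indicator (e s) x +
        (closedBall (0 : EuclideanSpace ℝ (Fin d)) α \ closedBall 0 (α - 2 * q)).indicator
          (fun _ => R ^ 2) x)
      ((integrable_finsetSum _ hindT).add hshellint)
      (fun x => add_nonneg (hsumnn x) (Set.indicator_nonneg (fun _ _ => sq_nonneg R) x)) ?_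
    · rw [integral_add (integrable_finsetSum _ hindT) hshellint, integral_finsetSum _ hindT,
        integral_indicator hshell, setIntegral_const, smul_eq_mul, mul_comm _ (R ^ 2)] at this
      simp only [integral_indicator (hcomp _).isClosed.measurableSet] at this
      rw [Finset.sum_congr rfl fun s hs =>
          hint s (D.indep (hmemD s hs).1) (hmemD s hs).2.1,
        Finset.sum_congr rfl fun s hs =>
          hint s (T.indep ((hmemT s).1 hs).1) ((hmemT s).1 hs).2.1] at this
      exact this
    · filter_upwards [hT.ae_mem_simplex hcount] with x ⟨t, htT, htc, hxt⟩ s hs hxs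
      obtain ⟨hsD, hsc, hsα⟩ := hmemD s hs
      obtain ⟨c, ρ, hρ0, hρ, hsρ, hXρ⟩ := hD.exists_circumsphere hX hsD hsc
      have hes : e s x ≤ ρ ^ 2 - dist x c ^ 2 :=
        hupp s (D.indep hsD) hsc x hxs c _ fun v hv => by rw [hsρ v hv]
      by_cases hxβ : x ∈ closedBall (0 : EuclideanSpace ℝ (Fin d)) (α - 2 * q)
      · obtain ⟨z, σ, -, hσ, hz⟩ := hcirc t htT htc
        have hxz : dist x z ≤ σ := mem_closedBall.1
          (convexHull_min (fun v hv => (hz v hv).le) (convex_closedBall z σ) hxt)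
        have htα : (t : Set (EuclideanSpace ℝ (Fin d))) ⊆ closedBall 0 α := fun v hv => by
          have h1 := dist_triangle v z x
          have h2 := dist_triangle v x 0
          rw [hz v hv, dist_comm z x] at h1
          rw [mem_closedBall] at hxβ ⊢
          linarith
        have ht : t ∈ (hfT α).toFinset := (hmemT t).2 ⟨htT, htc, htα⟩
        have het : ρ ^ 2 - dist x c ^ 2 ≤ e t x :=
          hlow t (T.indep htT) htc x hxt c _ fun v hv =>
            pow_le_pow_left₀ hρ0 (hXρ v (hT.coe_subset htT hv)) 2
        have hsingle := Finset.single_le_sum (f := fun s : Finset (EuclideanSpace ℝ (Fin d)) =>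
          (convexHull ℝ (s : Set (EuclideanSpace ℝ (Fin d)))).indicator (e s) x)
          (fun s hs => Set.indicator_nonneg
            (henn s ((hmemT s).1 hs).1 ((hmemT s).1 hs).2.1) x) ht
        rw [Set.indicator_of_mem hxt] at hsingle
        have h0 := Set.indicator_nonneg (s := closedBall (0 : EuclideanSpace ℝ (Fin d)) α \
          closedBall 0 (α - 2 * q)) (f := fun _ => R ^ 2) (fun _ _ => sq_nonneg R) x
        linarith
      · have hxα := convexHull_min hsα (convex_closedBall _ _) hxs
        rw [Set.indicator_of_mem (Set.mem_sdiff_of_mem hxα hxβ)]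
        have h1 := hsumnn x
        have h2 := pow_le_pow_left₀ hρ0 hρ 2
        have h3 := sq_nonneg (dist x c)
        linarith
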